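/- Let √2 − 1 < α < 1, let X be an ℕ-valued random variable satisfying the recursive distributional equation, and define h(s) := ((2−p)s + p)² − 4s·exp(α(s−1)). Then there exist 0 < t₁ < t₂ < 1 such that h(t₁) = 0 and h(1) = 0, h'(t₁) = h'(t₂) = 0, and h is strictly decreasing on (0, t₁), strictly increasing on (t₁, t₂), and strictly decreasing on (t₂, 1). -/

import Mathlib

open scoped ENNReal

/-- The Poisson(α) probability mass function on ℕ. -/
noncomputable def poissonPMF (α : ℝ) (k : ℕ) : ℝ≥0∞ :=
  ENNReal.ofReal (Real.exp (-α) * α ^ k / (Nat.factorial k))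

/-- The Geometric(1/2) pmf: P(N = k) = (1/2)^(k+1) for k ≥ 0. -/
noncomputable def geomHalf (k : ℕ) : ℝ≥0∞ := (1 / 2) ^ (k + 1)

/-- The law of (X - 1)⁺ when X has law μ on ℕ. -/
noncomputable def shiftLaw (μ : ℕ → ℝ≥0∞) (k : ℕ) : ℝ≥0∞ :=
  if k = 0 then μ 0 + μ 1 else μ (k + 1)

/-- Convolution of two (sub-)pmfs on ℕ: the law of an independent sum. -/
noncomputable def convAdd (f g : ℕ → ℝ≥0∞) (k : ℕ) : ℝ≥0∞ :=
  ∑ j ∈ Finset.range (k + 1), f j * g (k - j)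

/-- n-fold convolution of a pmf on ℕ: the law of a sum of n i.i.d. copies. -/
noncomputable def iterConv (f : ℕ → ℝ≥0∞) : ℕ → ℕ → ℝ≥0∞
  | 0 => fun k => if k = 0 then 1 else 0
  | n + 1 => convAdd (iterConv f n) f

/-- μ is the law of an ℕ-valued random variable X satisfying the RDE
    X =_d P + ∑_{i=1}^N (X_i - 1)⁺, with P ~ Poisson(α), N ~ Geom(1/2),
    X_i i.i.d. with law μ, all independent. -/
def SatisfiesRDE (α : ℝ) (μ : ℕ → ℝ≥0∞) : Prop :=
  (∑' k, μ k) = 1 ∧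
  ∀ k, μ k = ∑' n, geomHalf n * convAdd (poissonPMF α) (iterConv (shiftLaw μ) n) k

/-- The probability generating function G(s) = E[s^X]. -/
noncomputable def pgf (μ : ℕ → ℝ≥0∞) (s : ℝ) : ℝ := ∑' k, (μ k).toReal * s ^ k

/-- The mean E[X] = ∑ k · P(X = k), valued in [0,∞]. -/
noncomputable def meanENN (μ : ℕ → ℝ≥0∞) : ℝ≥0∞ := ∑' k : ℕ, (k : ℝ≥0∞) * μ k

/-- The generating function of a sequence in `[0, ∞]`. -/
noncomputable def genFun (f : ℕ → ℝ≥0∞) (x : ℝ≥0∞) : ℝ≥0∞ := ∑' k, f k * x ^ k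

lemma genFun_convAdd (f g : ℕ → ℝ≥0∞) (x : ℝ≥0∞) :
    genFun (convAdd f g) x = genFun f x * genFun g x := by
  have hprod : genFun f x * genFun g x =
      ∑' q : ℕ × ℕ, (f q.1 * x ^ q.1) * (g q.2 * x ^ q.2) := by
    rw [ENNReal.tsum_prod (f := fun i j => (f i * x ^ i) * (g j * x ^ j)), genFun, genFun, ← ENNReal.tsum_mul_right]
    simp_rw [ENNReal.tsum_mul_left]
  rw [hprod, ← Finset.HasAntidiagonal.sigmaAntidiagonalEquivProd.tsum_eq, ENNReal.tsum_sigma']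
  refine tsum_congr fun k => ?_
  rw [tsum_fintype, convAdd, ← Finset.Nat.sum_antidiagonal_eq_sum_range_succ
    (fun i j => f i * g j), Finset.sum_mul]
  rw [← Finset.sum_coe_sort]
  refine Finset.sum_congr rfl fun q _ => ?_
  have hq := Finset.HasAntidiagonal.mem_antidiagonal.1 q.2
  simp only [Finset.HasAntidiagonal.sigmaAntidiagonalEquivProd_apply]
  rw [show x ^ k = x ^ q.1.1 * x ^ q.1.2 by rw [← pow_add, hq]]
  ring

lemma genFun_iterConv (f : ℕ → ℝ≥0∞) (x : ℝ≥0∞) (n : ℕ) :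
    genFun (iterConv f n) x = genFun f x ^ n := by
  induction n with
  | zero =>
    rw [genFun, tsum_eq_single 0]
    · simp [iterConv]
    · intro k hk
      simp [iterConv, hk]
  | succ n ih => rw [iterConv, genFun_convAdd, ih, pow_succ]

lemma genFun_poissonPMF {α s : ℝ} (hα : 0 ≤ α) (hs : 0 ≤ s) :
    genFun (poissonPMF α) (ENNReal.ofReal s) = ENNReal.ofReal (Real.exp (α * (s - 1))) := by
  have hsum : HasSum (fun k : ℕ => Real.exp (-α) * ((α * s) ^ k / (k.factorial : ℝ)))
      (Real.exp (α * (s - 1))) := by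
    have := (NormedSpace.expSeries_div_hasSum_exp (𝔸 := ℝ) (α * s)).mul_left (Real.exp (-α))
    rw [← Real.exp_eq_exp_ℝ, ← Real.exp_add] at this
    rwa [show -α + α * s = α * (s - 1) by ring] at this
  rw [← hsum.tsum_eq, ENNReal.ofReal_tsum_of_nonneg (fun k => by positivity) hsum.summable, genFun]
  refine tsum_congr fun k => ?_
  rw [poissonPMF, ← ENNReal.ofReal_pow hs, ← ENNReal.ofReal_mul (by positivity)]
  congr 1
  rw [mul_pow]
  field_simp

lemma genFun_shiftLaw (μ : ℕ → ℝ≥0∞) (x : ℝ≥0∞) :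
    x * genFun (shiftLaw μ) x + μ 0 = genFun μ x + x * μ 0 := by
  have h1 : genFun (shiftLaw μ) x = μ 0 + ∑' k, μ (k + 1) * x ^ k := by
    rw [genFun, tsum_eq_zero_add' ENNReal.summable,
      tsum_eq_zero_add' (f := fun k => μ (k + 1) * x ^ k) ENNReal.summable]
    simp [shiftLaw, add_assoc]
  have h2 : genFun μ x = μ 0 + x * ∑' k, μ (k + 1) * x ^ k := by
    rw [genFun, tsum_eq_zero_add' ENNReal.summable, ← ENNReal.tsum_mul_left]
    simp only [pow_zero, mul_one]
    congr 1
    exact tsum_congr fun k => by ring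
  rw [h1, h2]
  ring

lemma genFun_le_tsum (f : ℕ → ℝ≥0∞) {x : ℝ≥0∞} (hx : x ≤ 1) : genFun f x ≤ ∑' k, f k :=
  ENNReal.tsum_le_tsum fun _ => mul_le_of_le_one_right' (pow_le_one' hx _)

lemma tsum_shiftLaw (μ : ℕ → ℝ≥0∞) : ∑' k, shiftLaw μ k = ∑' k, μ k := by
  rw [tsum_eq_zero_add' (f := shiftLaw μ) ENNReal.summable, tsum_eq_zero_add' (f := μ)
    ENNReal.summable, tsum_eq_zero_add' (f := fun k => μ (k + 1)) ENNReal.summable]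
  simp [shiftLaw, add_assoc]

namespace SatisfiesRDE

variable {α : ℝ} {μ : ℕ → ℝ≥0∞}

lemma ne_top (hμ : SatisfiesRDE α μ) (k : ℕ) : μ k ≠ ⊤ :=
  ne_top_of_le_ne_top ENNReal.one_ne_top (hμ.1 ▸ ENNReal.le_tsum k)

lemma genFun_eq (hμ : SatisfiesRDE α μ) (x : ℝ≥0∞) :
    genFun μ x =
      genFun (poissonPMF α) x * (2⁻¹ * (1 - 2⁻¹ * genFun (shiftLaw μ) x)⁻¹) := by
  have h1 : genFun μ x =
      ∑' n, geomHalf n * genFun (convAdd (poissonPMF α) (iterConv (shiftLaw μ) n)) x := by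
    simp_rw [genFun, ← ENNReal.tsum_mul_left]
    rw [ENNReal.tsum_comm]
    refine tsum_congr fun k => ?_
    rw [hμ.2 k, ← ENNReal.tsum_mul_right]
    exact tsum_congr fun n => by ring
  rw [h1, ← ENNReal.tsum_geometric, ← ENNReal.tsum_mul_left, ← ENNReal.tsum_mul_left]
  refine tsum_congr fun n => ?_
  rw [genFun_convAdd, genFun_iterConv, geomHalf, mul_pow, one_div]
  ring

lemma toReal_zero_pos (hμ : SatisfiesRDE α μ) : 0 < (μ 0).toReal := by
  refine ENNReal.toReal_pos ?_ (hμ.ne_top 0)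
  rw [hμ.2 0]
  refine ne_of_gt (lt_of_lt_of_le ?_ (ENNReal.le_tsum 0))
  have : 0 < poissonPMF α 0 := by
    simp [poissonPMF, Real.exp_pos]
  simp [geomHalf, convAdd, iterConv, this]

lemma pgf_eq_toReal (hμ : SatisfiesRDE α μ) {s : ℝ} (hs : 0 ≤ s) :
    pgf μ s = (genFun μ (ENNReal.ofReal s)).toReal := by
  rw [genFun, ENNReal.tsum_toReal_eq
    (fun k => ENNReal.mul_ne_top (hμ.ne_top k) (ENNReal.pow_ne_top ENNReal.ofReal_ne_top))]
  simp [pgf, ENNReal.toReal_ofReal hs]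

lemma pgf_le_one (hμ : SatisfiesRDE α μ) {s : ℝ} (hs : 0 ≤ s) (hs1 : s ≤ 1) : pgf μ s ≤ 1 := by
  rw [hμ.pgf_eq_toReal hs]
  refine ENNReal.toReal_le_of_le_ofReal zero_le_one ?_
  rw [ENNReal.ofReal_one, ← hμ.1]
  exact genFun_le_tsum μ (by simpa using ENNReal.ofReal_le_ofReal hs1)

lemma pgf_quadratic (hμ : SatisfiesRDE α μ) (hα : 0 ≤ α) {s : ℝ} (hs : 0 ≤ s) (hs1 : s ≤ 1) :
    pgf μ s * ((2 - (μ 0).toReal) * s + (μ 0).toReal - pgf μ s) =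
      s * Real.exp (α * (s - 1)) := by
  have hx : ENNReal.ofReal s ≤ 1 := by simpa using ENNReal.ofReal_le_ofReal hs1
  have hH1 : genFun (shiftLaw μ) (ENNReal.ofReal s) ≤ 1 :=
    (genFun_le_tsum _ hx).trans ((tsum_shiftLaw μ).trans hμ.1).le
  have hG1 : genFun μ (ENNReal.ofReal s) ≤ 1 := (genFun_le_tsum _ hx).trans hμ.1.le
  have hHtop := ne_top_of_le_ne_top ENNReal.one_ne_top hH1
  have hGtop := ne_top_of_le_ne_top ENNReal.one_ne_top hG1
  have e1 := congrArg ENNReal.toReal (hμ.genFun_eq (ENNReal.ofReal s))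
  have e2 := congrArg ENNReal.toReal (genFun_shiftLaw μ (ENNReal.ofReal s))
  have hH1' : (genFun (shiftLaw μ) (ENNReal.ofReal s)).toReal ≤ 1 :=
    ENNReal.toReal_le_of_le_ofReal zero_le_one (by simpa using hH1)
  have hle : 2⁻¹ * genFun (shiftLaw μ) (ENNReal.ofReal s) ≤ 1 :=
    mul_le_one' (by simp) hH1
  rw [genFun_poissonPMF hα hs, ENNReal.toReal_mul, ENNReal.toReal_mul, ENNReal.toReal_inv,
    ENNReal.toReal_inv, ENNReal.toReal_sub_of_le hle ENNReal.one_ne_top, ENNReal.toReal_mul,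
    ENNReal.toReal_inv, ENNReal.toReal_ofReal (Real.exp_pos _).le, ← hμ.pgf_eq_toReal hs] at e1
  rw [ENNReal.toReal_add (ENNReal.mul_ne_top ENNReal.ofReal_ne_top hHtop) (hμ.ne_top 0),
    ENNReal.toReal_add hGtop (ENNReal.mul_ne_top ENNReal.ofReal_ne_top (hμ.ne_top 0)),
    ENNReal.toReal_mul, ENNReal.toReal_mul, ENNReal.toReal_ofReal hs,
    ← hμ.pgf_eq_toReal hs] at e2
  generalize (genFun (shiftLaw μ) (ENNReal.ofReal s)).toReal = H at *
  simp only [ENNReal.toReal_ofNat, ENNReal.toReal_one] at e1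
  have hne : (1 : ℝ) - 2⁻¹ * H ≠ 0 := by linarith
  have e3 : pgf μ s * (2 - H) = Real.exp (α * (s - 1)) := by
    rw [e1]
    field_simp
    rw [div_self (by linarith)]
  linear_combination s * e3 + pgf μ s * e2

lemma continuousOn_pgf (hμ : SatisfiesRDE α μ) : ContinuousOn (pgf μ) (Set.Icc 0 1) := by
  refine continuousOn_tsum (u := fun k => (μ k).toReal) (fun k => by fun_prop)
    (ENNReal.summable_toReal (by rw [hμ.1]; simp)) fun k s hs => ?_
  rw [norm_mul, norm_pow, Real.norm_of_nonneg ENNReal.toReal_nonneg, Real.norm_of_nonneg hs.1]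
  exact mul_le_of_le_one_right ENNReal.toReal_nonneg (pow_le_one₀ hs.1 hs.2)

lemma pgf_zero (μ : ℕ → ℝ≥0∞) : pgf μ 0 = (μ 0).toReal := by
  rw [pgf, tsum_eq_single 0]
  · simp
  · intro k hk
    simp [hk]

lemma sq_two_mul_pgf_sub (hμ : SatisfiesRDE α μ) (hα : 0 ≤ α) {s : ℝ} (hs : 0 ≤ s) (hs1 : s ≤ 1) :
    (2 * pgf μ s - ((2 - (μ 0).toReal) * s + (μ 0).toReal)) ^ 2 =
      ((2 - (μ 0).toReal) * s + (μ 0).toReal) ^ 2 - 4 * s * Real.exp (α * (s - 1)) := by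
  linear_combination (-4) * hμ.pgf_quadratic hα hs hs1

/-- If the discriminant has no zero in `(0, 1)`, then the positive branch of the quadratic equation
is the right one throughout, and the discriminant vanishes to second order at `1`. -/
lemma discrim_le_of_ne_zero (hμ : SatisfiesRDE α μ) (hα : 0 ≤ α)
    (hne : ∀ s ∈ Set.Ioo (0 : ℝ) 1,
      ((2 - (μ 0).toReal) * s + (μ 0).toReal) ^ 2 - 4 * s * Real.exp (α * (s - 1)) ≠ 0)
    {s : ℝ} (hs : s ∈ Set.Ioo (0 : ℝ) 1) :
    ((2 - (μ 0).toReal) * s + (μ 0).toReal) ^ 2 - 4 * s * Real.exp (α * (s - 1)) ≤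
      (2 - (μ 0).toReal) ^ 2 * (1 - s) ^ 2 := by
  set p := (μ 0).toReal with hp
  have hp0 : 0 < p := hμ.toReal_zero_pos
  have hpos : 0 ≤ 2 * pgf μ s - ((2 - p) * s + p) := by
    by_contra! hneg
    have hcont : ContinuousOn (fun u => 2 * pgf μ u - ((2 - p) * u + p)) (Set.Icc 0 s) := by
      have := hμ.continuousOn_pgf.mono (Set.Icc_subset_Icc_right hs.2.le)
      fun_prop
    have hzero : (0 : ℝ) ∈ Set.Icc (2 * pgf μ s - ((2 - p) * s + p))
        (2 * pgf μ 0 - ((2 - p) * 0 + p)) := by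
      refine ⟨hneg.le, ?_⟩
      rw [pgf_zero, ← hp]
      linarith
    obtain ⟨u, hu, hu0⟩ := intermediate_value_Icc' hs.1.le hcont hzero
    simp only at hu0
    have hu1 : u < 1 := hu.2.trans_lt hs.2
    have hsq := hμ.sq_two_mul_pgf_sub hα hu.1 hu1.le
    rw [← hp, hu0] at hsq
    rcases hu.1.eq_or_lt with rfl | hu'
    · rw [pgf_zero, ← hp] at hu0
      linarith
    · exact hne u ⟨hu', hu1⟩ (by rw [← hsq]; ring)
  have hle : 2 * pgf μ s - ((2 - p) * s + p) ≤ (2 - p) * (1 - s) := by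
    linarith [hμ.pgf_le_one hs.1.le hs.2.le]
  rw [← hμ.sq_two_mul_pgf_sub hα hs.1.le hs.2.le, ← mul_pow]
  exact pow_le_pow_left₀ hpos hle 2

end SatisfiesRDE

section Discriminant

variable (α p : ℝ)

lemma hasDerivAt_discrim (s : ℝ) :
    HasDerivAt (fun s => ((2 - p) * s + p) ^ 2 - 4 * s * Real.exp (α * (s - 1)))
      (2 * (2 - p) * ((2 - p) * s + p) - 4 * (1 + α * s) * Real.exp (α * (s - 1))) s := by
  have h1 := ((((hasDerivAt_id s).const_mul (2 - p)).add_const p).pow 2)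
  have h2 := ((hasDerivAt_id s).const_mul 4).mul
    ((((hasDerivAt_id s).sub_const 1).const_mul α).exp)
  refine (h1.sub h2).congr_deriv ?_
  simp only [id]
  push_cast
  ring

lemma hasDerivAt_deriv_discrim (s : ℝ) :
    HasDerivAt
      (fun s => 2 * (2 - p) * ((2 - p) * s + p) - 4 * (1 + α * s) * Real.exp (α * (s - 1)))
      (2 * (2 - p) ^ 2 - 4 * α * (2 + α * s) * Real.exp (α * (s - 1))) s := by
  have h1 := (((hasDerivAt_id s).const_mul (2 - p)).add_const p).const_mul (2 * (2 - p))
  have h2 := ((((hasDerivAt_id s).const_mul α).const_add 1).const_mul 4).mul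
    ((((hasDerivAt_id s).sub_const 1).const_mul α).exp)
  refine (h1.sub h2).congr_deriv ?_
  simp only [id]
  ring

lemma strictConcaveOn_deriv_discrim {α : ℝ} (hα : 0 < α) :
    StrictConcaveOn ℝ (Set.Icc 0 1)
      (fun s => 2 * (2 - p) * ((2 - p) * s + p) - 4 * (1 + α * s) * Real.exp (α * (s - 1))) := by
  refine StrictAntiOn.strictConcaveOn_of_deriv (convex_Icc 0 1) (by fun_prop) ?_
  rw [interior_Icc, funext fun s => (hasDerivAt_deriv_discrim α p s).deriv]
  intro a ha b hb hab
  have hα0 : 0 < 4 * α := by linarith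
  have h1 : 4 * α * (2 + α * a) < 4 * α * (2 + α * b) := by gcongr
  have h2 : Real.exp (α * (a - 1)) < Real.exp (α * (b - 1)) := by gcongr
  have h3 : 0 ≤ 4 * α * (2 + α * a) := by have := ha.1; positivity
  have := mul_lt_mul'' h1 h2 h3 (Real.exp_pos _).le
  simp only
  linarith

end Discriminant

/-- A strictly concave function with two zeros is negative, positive, negative. -/
lemma StrictConcaveOn.sign_of_zeros {f : ℝ → ℝ} {S : Set ℝ} (hf : StrictConcaveOn ℝ S f)
    {a b : ℝ} (ha : a ∈ S) (hb : b ∈ S) (hab : a < b) (hfa : f a = 0) (hfb : f b = 0) :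
    (∀ s ∈ S, s < a → f s < 0) ∧ (∀ s, a < s → s < b → 0 < f s) ∧ (∀ s ∈ S, b < s → f s < 0) := by
  refine ⟨fun s hs hsa => ?_, fun s has hsb => ?_, fun s hs hbs => ?_⟩
  · have := hf.slope_anti_adjacent hs hb hsa hab
    rw [hfa, hfb, sub_self, zero_div, zero_sub, div_pos_iff_of_pos_right (by linarith)] at this
    linarith
  · have hs : s ∈ openSegment ℝ a b := by
      rw [openSegment_eq_Ioo hab]
      exact ⟨has, hsb⟩
    simpa [hfa, hfb] using hf.lt_on_openSegment ha hb hab.ne hs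
  · have := hf.slope_anti_adjacent ha hs hab hbs
    rw [hfa, hfb, sub_self, zero_div, sub_zero, div_lt_iff₀ (by linarith)] at this
    linarith

/-- A function bounded below by zero and above by a quadratic to the left of a zero has zero
derivative there. -/
lemma HasDerivAt.eq_zero_of_le_sq {f : ℝ → ℝ} {f' C : ℝ} (hf : HasDerivAt f f' 1) (hf1 : f 1 = 0)
    (h0 : ∀ s ∈ Set.Ioo (0 : ℝ) 1, 0 ≤ f s)
    (hC : ∀ s ∈ Set.Ioo (0 : ℝ) 1, f s ≤ C * (1 - s) ^ 2) : f' = 0 := by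
  have hmem : ∀ᶠ s in nhdsWithin (1 : ℝ) (Set.Iio 1), s ∈ Set.Ioo (0 : ℝ) 1 :=
    Ioo_mem_nhdsLT one_pos
  have hslope : Filter.Tendsto (slope f 1) (nhdsWithin 1 (Set.Iio 1)) (nhds f') :=
    (hasDerivWithinAt_iff_tendsto_slope' (by simp)).1 hf.hasDerivWithinAt
  have hlim : Filter.Tendsto (fun s : ℝ => -(C * (1 - s))) (nhdsWithin 1 (Set.Iio 1)) (nhds 0) := by
    have : Continuous fun s : ℝ => -(C * (1 - s)) := by fun_prop
    simpa using (this.tendsto 1).mono_left nhdsWithin_le_nhds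
  refine le_antisymm (le_of_tendsto hslope ?_) (le_of_tendsto_of_tendsto hlim hslope ?_)
  · filter_upwards [hmem] with s hs
    rw [slope_def_field, hf1, sub_zero]
    exact div_nonpos_of_nonneg_of_nonpos (h0 s hs) (by linarith [hs.2])
  · filter_upwards [hmem] with s hs
    rw [slope_def_field, hf1, sub_zero, le_div_iff_of_neg (by linarith [hs.2])]
    linarith [hC s hs]

lemma SatisfiesRDE.exists_discrim_eq_zero {α : ℝ} {μ : ℕ → ℝ≥0∞} (hμ : SatisfiesRDE α μ)
    (hα : Real.sqrt 2 - 1 < α) :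
    ∃ s ∈ Set.Ioo (0 : ℝ) 1,
      ((2 - (μ 0).toReal) * s + (μ 0).toReal) ^ 2 - 4 * s * Real.exp (α * (s - 1)) = 0 := by
  have hsqrt : (1 : ℝ) < Real.sqrt 2 := Real.lt_sqrt_of_sq_lt (by norm_num)
  have hα0 : 0 < α := by linarith
  by_contra! hne
  have hle := fun s hs => hμ.discrim_le_of_ne_zero hα0.le hne (s := s) hs
  set p := (μ 0).toReal
  set f : ℝ → ℝ := fun s => ((2 - p) * s + p) ^ 2 - 4 * s * Real.exp (α * (s - 1)) with hf
  have hf1 : f 1 = 0 := by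
    simp [hf]
    norm_num
  have hnn : ∀ s ∈ Set.Ioo (0 : ℝ) 1, 0 ≤ f s := fun s hs =>
    (sq_nonneg _).trans_eq (hμ.sq_two_mul_pgf_sub hα0.le hs.1.le hs.2.le)
  have hd := (hasDerivAt_discrim α p 1).eq_zero_of_le_sq hf1 hnn hle
  have hp : p = 1 - α := by
    simp at hd
    nlinarith
  have hdf : deriv f = fun s =>
      2 * (2 - p) * ((2 - p) * s + p) - 4 * (1 + α * s) * Real.exp (α * (s - 1)) :=
    funext fun s => (hasDerivAt_discrim α p s).deriv
  have hmax : IsLocalMax f 1 := by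
    refine isLocalMax_of_deriv_deriv_neg ?_ (by rw [hdf]; exact hd)
      (hasDerivAt_discrim α p 1).continuousAt
    rw [hdf, (hasDerivAt_deriv_discrim α p 1).deriv, hp]
    simp only [sub_self, mul_zero, Real.exp_zero]
    nlinarith [Real.sq_sqrt (show (0 : ℝ) ≤ 2 by norm_num)]
  have hmem : ∀ᶠ s in nhdsWithin (1 : ℝ) (Set.Iio 1), s ∈ Set.Ioo (0 : ℝ) 1 :=
    Ioo_mem_nhdsLT one_pos
  obtain ⟨s, hs, hsle⟩ := (hmem.and (hmax.filter_mono nhdsWithin_le_nhds)).exists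
  exact hne s hs (le_antisymm (hsle.trans_eq hf1) (hnn s hs))

/-- For √2 − 1 < α < 1 and h(s) = ((2−p)s + p)² − 4s·exp(α(s−1)), there
exist 0 < t₁ < t₂ < 1 with h(t₁) = h(1) = 0, h'(t₁) = h'(t₂) = 0, and h strictly
decreasing on (0,t₁), strictly increasing on (t₁,t₂), strictly decreasing on (t₂,1). -/
theorem h_shape_large_alpha
    (α : ℝ) (hα0 : Real.sqrt 2 - 1 < α) (hα1 : α < 1)
    (μ : ℕ → ℝ≥0∞) (hμ : SatisfiesRDE α μ)
    (p : ℝ) (hp : p = (μ 0).toReal)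
    (h : ℝ → ℝ)
    (hh : ∀ s : ℝ, h s = ((2 - p) * s + p) ^ 2 - 4 * s * Real.exp (α * (s - 1))) :
    ∃ t₁ t₂ : ℝ, 0 < t₁ ∧ t₁ < t₂ ∧ t₂ < 1 ∧
      h t₁ = 0 ∧ h 1 = 0 ∧
      deriv h t₁ = 0 ∧ deriv h t₂ = 0 ∧
      StrictAntiOn h (Set.Ioo 0 t₁) ∧
      StrictMonoOn h (Set.Ioo t₁ t₂) ∧
      StrictAntiOn h (Set.Ioo t₂ 1) := by
  obtain rfl : h = fun s => ((2 - p) * s + p) ^ 2 - 4 * s * Real.exp (α * (s - 1)) := funext hh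
  have hsqrt : (1 : ℝ) < Real.sqrt 2 := Real.lt_sqrt_of_sq_lt (by norm_num)
  have hα : 0 < α := by linarith
  obtain ⟨t₁, ht₁, hzero⟩ := hμ.exists_discrim_eq_zero hα0
  have hsq := fun s (hs : 0 ≤ s) (hs1 : s ≤ 1) => hμ.sq_two_mul_pgf_sub hα.le hs hs1
  rw [← hp] at hzero hsq
  set f : ℝ → ℝ := fun s => ((2 - p) * s + p) ^ 2 - 4 * s * Real.exp (α * (s - 1)) with hf
  have hf1 : f 1 = 0 := by
    simp [hf]
    norm_num
  have hd := hasDerivAt_discrim α p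
  have hcont : Continuous f := by fun_prop
  have hdf : ∀ s, deriv f s = _ := fun s => (hd s).deriv
  have hmin : IsLocalMin f t₁ := by
    filter_upwards [Ioo_mem_nhds ht₁.1 ht₁.2] with s hs
    exact hzero.trans_le ((sq_nonneg _).trans_eq (hsq s hs.1.le hs.2.le))
  obtain ⟨t₂, ht₂, hdt₂⟩ := exists_deriv_eq_zero ht₁.2 hcont.continuousOn (hzero.trans hf1.symm)
  have hdt₁ := hmin.deriv_eq_zero
  obtain ⟨hlt, hmid, hgt⟩ := (strictConcaveOn_deriv_discrim p hα).sign_of_zeros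
    (Set.Ioo_subset_Icc_self ht₁) ⟨(ht₁.1.trans ht₂.1).le, ht₂.2.le⟩ ht₂.1
    ((hdf t₁).symm.trans hdt₁) ((hdf t₂).symm.trans hdt₂)
  refine ⟨t₁, t₂, ht₁.1, ht₂.1, ht₂.2, hzero, hf1, hdt₁, hdt₂, ?_, ?_, ?_⟩
  · refine strictAntiOn_of_deriv_neg (convex_Ioo _ _) hcont.continuousOn fun s hs => ?_
    rw [interior_Ioo] at hs
    rw [hdf]
    exact hlt s ⟨hs.1.le, (hs.2.trans ht₁.2).le⟩ hs.2
  · refine strictMonoOn_of_deriv_pos (convex_Ioo _ _) hcont.continuousOn fun s hs => ?_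
    rw [interior_Ioo] at hs
    rw [hdf]
    exact hmid s hs.1 hs.2
  · refine strictAntiOn_of_deriv_neg (convex_Ioo _ _) hcont.continuousOn fun s hs => ?_
    rw [interior_Ioo] at hs
    rw [hdf]
    exact hgt s ⟨(ht₁.1.trans (ht₂.1.trans hs.1)).le, hs.2.le⟩ hs.1
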